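/- Let Ω be a simply connected topological space and 𝒰 an open covering of Ω by path-connected open sets. Let ℐ = {(U,V) ∈ 𝒰 × 𝒰 : U ∩ V ≠ ∅} and let d : ℐ → ℝ be a coupling satisfying d_{UV} = −d_{VU} for all (U,V) ∈ ℐ, and d_{UW} = d_{UV} + d_{VW} whenever U ∩ V ∩ W ≠ ∅. Then there exists a primitive C : 𝒰 → ℝ of d, i.e. a function with d_{UV} = C_V − C_U for all (U,V) ∈ ℐ. -/

import Mathlib

open Set unitInterval

/-- Monodromy along a path contained in the base set of a trivialization with discrete fiber
preserves the fiber coordinate. -/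
theorem IsCoveringMap.trivialization_monodromy_snd {E X F : Type*} [TopologicalSpace E]
    [TopologicalSpace X] [TopologicalSpace F] [DiscreteTopology F] {p : E → X}
    (cov : IsCoveringMap p) (e : Bundle.Trivialization F p) {x y : X} (γ : Path x y)
    (hγ : ∀ t, γ t ∈ e.baseSet) (z : p ⁻¹' {x}) :
    (e (cov.monodromy (.mk γ) z : E)).2 = (e (z : E)).2 := by
  have h0 : γ.toContinuousMap 0 = p z := γ.source.trans z.2.symm
  let Γ := cov.liftPath γ z h0
  have hmem (t : I) : Γ t ∈ e.source := by
    rw [e.mem_source, show p (Γ t) = γ t from congrFun (cov.liftPath_lifts γ z h0) t]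
    exact hγ t
  have hcont : Continuous fun t : I ↦ (e (Γ t)).2 :=
    (e.continuousOn_toFun.comp_continuous Γ.continuous hmem).snd
  have hconst : (e (Γ 1)).2 = (e (Γ 0)).2 :=
    PreconnectedSpace.constant inferInstance hcont
  rwa [show Γ 0 = z from cov.liftPath_zero γ z h0] at hconst

/-- A fiber bundle core with discrete fiber over a simply connected space, with path-connected base
sets, has a section which is constant in each of the local trivializations. -/
theorem FiberBundleCore.exists_locally_constant_section {ι X F : Type*} [TopologicalSpace X]
    [SimplyConnectedSpace X] [TopologicalSpace F] [DiscreteTopology F] [Nonempty F]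
    (Z : FiberBundleCore ι X F) (hpc : ∀ i, IsPathConnected (Z.baseSet i)) :
    ∃ c : ι → F, ∀ i j, ∀ x ∈ Z.baseSet i ∩ Z.baseSet j, Z.coordChange i j x (c i) = c j := by
  have cov : IsCoveringMap Z.proj := FiberBundle.isCoveringMap (F := F) (E := Z.Fiber)
  obtain ⟨x₀⟩ : Nonempty X := inferInstance
  obtain ⟨v₀⟩ := ‹Nonempty F›
  let z₀ : Z.proj ⁻¹' {x₀} := ⟨⟨x₀, v₀⟩, rfl⟩
  let s (x : X) : Z.proj ⁻¹' {x} := cov.monodromy (.mk (PathConnectedSpace.somePath x₀ x)) z₀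
  let c (i : ι) (x : X) : F := (Z.localTriv i (s x : Z.TotalSpace)).2
  have hs {x y : X} (γ : Path x y) : s y = cov.monodromy (.mk γ) (s x) := by
    rw [← cov.monodromy_trans_apply]
    exact congrArg (fun q ↦ cov.monodromy q z₀) (Subsingleton.elim _ _)
  have hc (i : ι) {x y : X} (hx : x ∈ Z.baseSet i) (hy : y ∈ Z.baseSet i) : c i y = c i x := by
    obtain ⟨γ, hγ⟩ := (hpc i).joinedIn x hx y hy
    change (Z.localTriv i (s y : Z.TotalSpace)).2 = _
    rw [hs γ]
    exact cov.trivialization_monodromy_snd (Z.localTriv i) γ hγ (s x)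
  choose b hb using fun i ↦ (hpc i).nonempty
  refine ⟨fun i ↦ c i (b i), fun i j x hx ↦ ?_⟩
  beta_reduce
  rw [hc i hx.1 (hb i), hc j hx.2 (hb j)]
  have hp : (s x : Z.TotalSpace).1 = x := (s x).2
  have hmem := Z.mem_baseSet_at (s x : Z.TotalSpace).1
  have hcomp := Z.coordChange_comp (Z.indexAt (s x : Z.TotalSpace).1) i j
    (s x : Z.TotalSpace).1 ⟨⟨hmem, hp.symm ▸ hx.1⟩, hp.symm ▸ hx.2⟩ (s x : Z.TotalSpace).2
  refine Eq.trans ?_ hcomp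
  exact congrArg (fun y ↦ Z.coordChange i j y (c i x)) hp.symm

/-- A constant additive Čech cocycle on a path-connected open cover of a simply connected space is
a coboundary. -/
theorem exists_sub_eq_of_cocycle {ι X A : Type*} [TopologicalSpace X] [SimplyConnectedSpace X]
    [AddCommGroup A] (U : ι → Set X) (hopen : ∀ i, IsOpen (U i))
    (hpc : ∀ i, IsPathConnected (U i)) (hcover : ∀ x, ∃ i, x ∈ U i) (g : ι → ι → A)
    (hg : ∀ i j k, (U i ∩ U j ∩ U k).Nonempty → g i k = g i j + g j k) :
    ∃ c : ι → A, ∀ i j, (U i ∩ U j).Nonempty → g i j = c j - c i := by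
  let _ : TopologicalSpace A := ⊥
  have : DiscreteTopology A := ⟨rfl⟩
  choose index hindex using hcover
  let Z : FiberBundleCore ι X A :=
    { baseSet := U
      isOpen_baseSet := hopen
      indexAt := index
      mem_baseSet_at := hindex
      coordChange i j _ v := v + g i j
      coordChange_self i x hx v := by simpa using hg i i i ⟨x, ⟨hx, hx⟩, hx⟩
      continuousOn_coordChange i j :=
        ((continuous_of_discreteTopology (f := fun v : A ↦ v + g i j)).comp
          continuous_snd).continuousOn
      coordChange_comp i j k x hx v := by rw [hg i j k ⟨x, hx⟩, add_assoc] }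
  obtain ⟨c, hc⟩ := Z.exists_locally_constant_section hpc
  exact ⟨c, fun i j ⟨x, hx⟩ ↦ eq_sub_of_add_eq' (hc i j x hx)⟩

theorem stmt_0 {Ω : Type*} [TopologicalSpace Ω] [SimplyConnectedSpace Ω]
    (𝒰 : Set (Set Ω)) (hopen : ∀ U ∈ 𝒰, IsOpen U) (hpc : ∀ U ∈ 𝒰, IsPathConnected U)
    (hcover : ⋃₀ 𝒰 = Set.univ)
    (d : Set Ω → Set Ω → ℝ)
    (hanti : ∀ U ∈ 𝒰, ∀ V ∈ 𝒰, (U ∩ V).Nonempty → d U V = - d V U)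
    (hcoc : ∀ U ∈ 𝒰, ∀ V ∈ 𝒰, ∀ W ∈ 𝒰, (U ∩ V ∩ W).Nonempty → d U W = d U V + d V W) :
    ∃ C : Set Ω → ℝ, ∀ U ∈ 𝒰, ∀ V ∈ 𝒰, (U ∩ V).Nonempty → d U V = C V - C U := by
  classical
  obtain ⟨c, hc⟩ := exists_sub_eq_of_cocycle (fun U : 𝒰 ↦ (U : Set Ω)) (fun U ↦ hopen U U.2)
    (fun U ↦ hpc U U.2)
    (fun x ↦ by
      obtain ⟨U, hU, hx⟩ := mem_sUnion.mp (hcover ▸ mem_univ x)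
      exact ⟨⟨U, hU⟩, hx⟩)
    (fun U V ↦ d U V) (fun U V W ↦ hcoc U U.2 V V.2 W W.2)
  refine ⟨fun U ↦ if hU : U ∈ 𝒰 then c ⟨U, hU⟩ else 0, fun U hU V hV hUV ↦ ?_⟩
  simpa [hU, hV] using hc ⟨U, hU⟩ ⟨V, hV⟩ hUV
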